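/- Let q be a prime power, let n > s ≥ 1 and r > h ≥ 1 be integers, and set g := gcd(r,h) (so that [g]_q divides both [r]_q and [r−h]_q). If [h]_q·n ≥ g_q(r, q^{h−1}·(n−s)), then there exists t₀ ∈ ℕ such that for every integer t ≥ t₀ there exists a faithful projective h-(n + t·[r]_q/[g]_q, r, s + t·[r−h]_q/[g]_q)_q system. -/

import Mathlib

open scoped Classical

noncomputable section

/-- `[i]_q = 1 + q + ⋯ + q^(i-1)`, with `[0]_q = 0`. -/
def gNum (q i : ℕ) : ℕ := ∑ j ∈ Finset.range i, q ^ j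

/-- The Griesmer function `g_q(k,d) = ∑_{i=0}^{k-1} ⌈d / qⁱ⌉`. -/
def griesmer (q k d : ℕ) : ℕ := ∑ i ∈ Finset.range k, (d + q ^ i - 1) / q ^ i

/-- The number of elements of the multiset `S` of subspaces contained in the subspace `U`,
counted with multiplicity. -/
def cnt {F V : Type*} [Field F] [AddCommGroup V] [Module F V]
    (S : Multiset (Submodule F V)) (U : Submodule F V) : ℕ :=
  Multiset.countP (fun W => W ≤ U) S

/-- `S` is a projective `h-(n,r,s)_q` system in `F^r`. -/
def IsSystem {F : Type*} [Field F] [Fintype F] {r : ℕ} (h n s : ℕ)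
    (S : Multiset (Submodule F (Fin r → F))) : Prop :=
  Multiset.card S = n ∧ (∀ W ∈ S, Module.finrank F W ≤ h) ∧
  (∀ H : Submodule F (Fin r → F), Module.finrank F H = r - 1 → cnt S H ≤ s) ∧
  (∃ H : Submodule F (Fin r → F), Module.finrank F H = r - 1 ∧ cnt S H = s)

/-- `S` is faithful: every element has dimension exactly `h`. -/
def IsFaithful {F : Type*} [Field F] [Fintype F] {r : ℕ} (h : ℕ)
    (S : Multiset (Submodule F (Fin r → F))) : Prop :=
  ∀ W ∈ S, Module.finrank F W = h

lemma gNum_succ (q i : ℕ) : gNum q (i+1) = gNum q i + q ^ i := by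
  simp [gNum, Finset.sum_range_succ]

lemma gNum_succ' (q i : ℕ) : gNum q (i+1) = q * gNum q i + 1 := by
  simp [gNum, Finset.sum_range_succ', Finset.mul_sum, pow_succ']

lemma gNum_add (q a b : ℕ) : gNum q (a + b) = gNum q a + q ^ a * gNum q b := by
  simp [gNum, Finset.sum_range_add, Finset.mul_sum, pow_add]

lemma gNum_dvd (q a b : ℕ) (hab : a ∣ b) : gNum q a ∣ gNum q b := by
  obtain ⟨c, rfl⟩ := hab
  induction c with
  | zero => simp [gNum]
  | succ c ih =>
    rw [Nat.mul_succ, gNum_add]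
    exact dvd_add ih (Dvd.intro_left _ rfl)

lemma gNum_pow (q i : ℕ) : ((q:ℤ) - 1) * gNum q i = (q:ℤ) ^ i - 1 := by
  induction i with
  | zero => simp [gNum]
  | succ i ih => rw [gNum_succ]; push_cast; rw [mul_add, ih]; ring

section geo
set_option linter.unusedSectionVars false
variable {F V : Type*} [Field F] [Fintype F] [AddCommGroup V] [Module F V] [Fintype V]

lemma card_filter_mem (D : Submodule F V) :
    ((Finset.univ : Finset V).filter (fun v => v ∈ D)).card
      = Fintype.card F ^ Module.finrank F D := by
  rw [← Module.card_eq_pow_finrank (K := F) (V := D), Fintype.card_subtype]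

lemma card_filter_diff (C D : Submodule F V) (h : C ≤ D) :
    (((Finset.univ : Finset V).filter (fun v => v ∈ D ∧ v ∉ C)).card : ℤ)
      = (Fintype.card F : ℤ) ^ Module.finrank F D - (Fintype.card F : ℤ) ^ Module.finrank F C := by
  have h1 := card_filter_mem D
  have h2 := card_filter_mem C
  have h3 : (Finset.univ : Finset V).filter (fun v => v ∈ D ∧ v ∉ C) =
      (Finset.univ : Finset V).filter (fun v => v ∈ D) \
      (Finset.univ : Finset V).filter (fun v => v ∈ C) := by
    ext v; simp
  rw [h3, Finset.cast_card_sdiff, h1, h2]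
  · push_cast; rfl
  · intro v; simp; exact fun hv => h hv

lemma finrank_sup_span (C : Submodule F V) (v : V) (hv : v ∉ C) :
    Module.finrank F ↥(C ⊔ F ∙ v) = Module.finrank F C + 1 := by
  have h0 : v ≠ 0 := by rintro rfl; exact hv C.zero_mem
  have := Submodule.finrank_sup_add_finrank_inf_eq C (F ∙ v)
  have hd : C ⊓ (F ∙ v) = ⊥ := by
    rw [← disjoint_iff]
    exact (Submodule.disjoint_span_singleton' h0).2 hv
  rw [hd, finrank_bot, finrank_span_singleton h0] at this
  omega

lemma one_lt_q : (1:ℤ) < Fintype.card F := by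
  exact_mod_cast Fintype.one_lt_card (α := F)

lemma card_between (C D : Submodule F V) (h : C ≤ D) (m : ℕ)
    (hm : Module.finrank F D = Module.finrank F C + m) :
    ((Finset.univ : Finset (Submodule F V)).filter
      (fun S => (C ≤ S ∧ S ≤ D) ∧ Module.finrank F S = Module.finrank F C + 1)).card
      = gNum (Fintype.card F) m := by
  set T := (Finset.univ : Finset (Submodule F V)).filter
      (fun S => (C ≤ S ∧ S ≤ D) ∧ Module.finrank F S = Module.finrank F C + 1) with hT
  have key := Finset.card_eq_sum_card_fiberwise
    (s := (Finset.univ : Finset V).filter (fun v => v ∈ D ∧ v ∉ C)) (t := T)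
    (f := fun v => C ⊔ F ∙ v) (by
      intro v hv
      simp only [Finset.coe_filter, Finset.mem_univ, true_and, Set.mem_ofPred_eq] at hv
      simp only [hT, Finset.coe_filter, Finset.mem_univ, true_and, Set.mem_ofPred_eq]
      refine ⟨⟨le_sup_left, sup_le h ?_⟩, finrank_sup_span C v hv.2⟩
      rw [Submodule.span_singleton_le_iff_mem]; exact hv.1)
  have key2 : ∀ S ∈ T, ((((Finset.univ : Finset V).filter (fun v => v ∈ D ∧ v ∉ C)).filter
      (fun v => C ⊔ F ∙ v = S)).card : ℤ) =
      (Fintype.card F : ℤ) ^ (Module.finrank F C) * ((Fintype.card F : ℤ) - 1) := by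
    intro S hS
    simp only [hT, Finset.mem_filter, Finset.mem_univ, true_and] at hS
    have := card_filter_diff C S hS.1.1
    rw [hS.2] at this
    rw [show (Fintype.card F : ℤ) ^ (Module.finrank F C) * ((Fintype.card F : ℤ) - 1) =
      (Fintype.card F : ℤ) ^ (Module.finrank F C + 1) - (Fintype.card F : ℤ) ^ (Module.finrank F C)
      by ring, ← this]
    congr 2
    ext v
    simp only [Finset.mem_filter, Finset.mem_univ, true_and]
    constructor
    · rintro ⟨⟨h1, h2⟩, rfl⟩
      exact ⟨Submodule.mem_sup_right (Submodule.mem_span_singleton_self v), h2⟩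
    · rintro ⟨h1, h2⟩
      refine ⟨⟨hS.1.2 h1, h2⟩, ?_⟩
      refine Submodule.eq_of_le_of_finrank_eq (sup_le hS.1.1 ?_) ?_
      · rw [Submodule.span_singleton_le_iff_mem]; exact h1
      · rw [finrank_sup_span C v h2, hS.2]
  have key3 := congrArg (Nat.cast : ℕ → ℤ) key
  rw [card_filter_diff C D h, Nat.cast_sum, Finset.sum_congr rfl key2, hm, pow_add] at key3
  simp only [Finset.sum_const, nsmul_eq_mul] at key3
  have hq := one_lt_q (F := F)
  have hg := gNum_pow (Fintype.card F) m
  have hp : (0:ℤ) < (Fintype.card F : ℤ) ^ (Module.finrank F C) := by positivity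
  have : (T.card : ℤ) = gNum (Fintype.card F) m := by
    have h1 : ((Fintype.card F : ℤ) ^ (Module.finrank F C) * ((Fintype.card F : ℤ) - 1)) ≠ 0 :=
      mul_ne_zero hp.ne' (by omega)
    apply mul_right_cancel₀ h1
    rw [← key3]
    linear_combination (-(Fintype.card F : ℤ) ^ (Module.finrank F C)) * hg
  exact_mod_cast this

lemma exists_between_finrank (C D : Submodule F V) (h : C ≤ D) (m : ℕ)
    (h1 : Module.finrank F C ≤ m) (h2 : m ≤ Module.finrank F D) :
    ∃ S : Submodule F V, C ≤ S ∧ S ≤ D ∧ Module.finrank F S = m := by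
  obtain ⟨j, rfl⟩ := Nat.exists_eq_add_of_le h1
  induction j with
  | zero => exact ⟨C, le_rfl, h, rfl⟩
  | succ j ih =>
    obtain ⟨S, a, b, c⟩ := ih (by omega) (by omega)
    have hne : ¬ D ≤ S := by
      intro hle
      have := Submodule.finrank_mono hle
      omega
    obtain ⟨v, hv, hvS⟩ := SetLike.not_le_iff_exists.1 hne
    refine ⟨S ⊔ F ∙ v, a.trans le_sup_left, sup_le b ?_, ?_⟩
    · rw [Submodule.span_singleton_le_iff_mem]; exact hv
    · rw [finrank_sup_span S v hvS]; omega

/-- Hyperplanes containing a given subspace. -/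
lemma card_hyper_above (U : Submodule F V) (d m : ℕ) (hd : Module.finrank F V = d + 1)
    (hU : Module.finrank F U + m = d + 1) :
    ((Finset.univ : Finset (Submodule F V)).filter
      (fun S : Submodule F V => U ≤ S ∧ Module.finrank F S = d)).card
      = gNum (Fintype.card F) m := by
  have : Finite (Module.Dual F V) := Module.finite_of_finite F
  have : Fintype (Module.Dual F V) := Fintype.ofFinite _
  have h0 := Subspace.finrank_add_finrank_dualAnnihilator_eq U
  have h1 := card_between (F := F) (⊥ : Submodule F (Module.Dual F V)) U.dualAnnihilator bot_le m
    (by simp; omega)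
  rw [← h1]
  refine Finset.card_bij (fun (S : Submodule F V) _ => S.dualAnnihilator) ?_ ?_ ?_
  · intro S hS
    simp only [Finset.mem_filter, Finset.mem_univ, true_and] at hS
    have := Subspace.finrank_add_finrank_dualAnnihilator_eq S
    simp only [Finset.mem_filter, Finset.mem_univ, true_and, bot_le, finrank_bot]
    exact ⟨Submodule.dualAnnihilator_anti hS.1, by omega⟩
  · intro S _ S' _ h
    exact Subspace.dualAnnihilator_inj.1 h
  · intro W hW
    simp only [Finset.mem_filter, Finset.mem_univ, true_and, bot_le, finrank_bot] at hW
    have h4 : W.dualCoannihilator.dualAnnihilator = W :=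
      Subspace.dualCoannihilator_dualAnnihilator_eq
    refine ⟨W.dualCoannihilator, ?_, h4⟩
    have := Subspace.finrank_add_finrank_dualAnnihilator_eq W.dualCoannihilator
    rw [h4] at this
    simp only [Finset.mem_filter, Finset.mem_univ, true_and]
    refine ⟨?_, by omega⟩
    rw [← Subspace.dualAnnihilator_le_dualAnnihilator_iff, h4]
    exact hW.1

lemma card_hyper (d : ℕ) (hd : Module.finrank F V = d + 1) :
    ((Finset.univ : Finset (Submodule F V)).filter
      (fun S : Submodule F V => Module.finrank F S = d)).card = gNum (Fintype.card F) (d+1) := by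
  rw [← card_hyper_above (⊥ : Submodule F V) d (d+1) hd (by simp)]
  simp

lemma card_sub_in (D : Submodule F V) (d : ℕ) :
    ((Finset.univ : Finset (Submodule F V)).filter
      (fun S : Submodule F V => S ≤ D ∧ Module.finrank F S = d)).card =
    ((Finset.univ : Finset (Submodule F D)).filter
      (fun S : Submodule F D => Module.finrank F S = d)).card := by
  symm
  refine Finset.card_bij (fun (S : Submodule F D) _ => S.map D.subtype) ?_ ?_ ?_
  · intro S hS
    simp only [Finset.mem_filter, Finset.mem_univ, true_and] at hS ⊢
    refine ⟨Submodule.map_subtype_le D S, ?_⟩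
    rw [← hS]
    exact Submodule.finrank_map_subtype_eq D S
  · intro S _ S' _ h
    exact Submodule.map_injective_of_injective D.injective_subtype h
  · intro W hW
    simp only [Finset.mem_filter, Finset.mem_univ, true_and] at hW
    have h3 : (W.comap D.subtype).map D.subtype = W := by
      rw [Submodule.map_comap_subtype, inf_eq_right.2 hW.1]
    refine ⟨W.comap D.subtype, ?_, h3⟩
    simp only [Finset.mem_filter, Finset.mem_univ, true_and]
    rw [← Submodule.finrank_map_subtype_eq D, h3, hW.2]

lemma card_hyper_in (D : Submodule F V) (d : ℕ) (hd : Module.finrank F D = d + 1) :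
    ((Finset.univ : Finset (Submodule F V)).filter
      (fun S : Submodule F V => S ≤ D ∧ Module.finrank F S = d)).card
      = gNum (Fintype.card F) (d+1) := by
  rw [card_sub_in, card_hyper (V := D) d hd]

lemma card_sub_congr (D D' : Submodule F V) (d : ℕ)
    (hD : Module.finrank F D = Module.finrank F D') :
    ((Finset.univ : Finset (Submodule F V)).filter
      (fun S : Submodule F V => S ≤ D ∧ Module.finrank F S = d)).card =
    ((Finset.univ : Finset (Submodule F V)).filter
      (fun S : Submodule F V => S ≤ D' ∧ Module.finrank F S = d)).card := by
  rw [card_sub_in, card_sub_in]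
  let e : D ≃ₗ[F] D' := LinearEquiv.ofFinrankEq _ _ hD
  refine Finset.card_bij (fun (S : Submodule F D) _ => S.map (e : D →ₗ[F] D')) ?_ ?_ ?_
  · intro S hS
    simp only [Finset.mem_filter, Finset.mem_univ, true_and] at hS ⊢
    rw [← hS]
    exact LinearEquiv.finrank_map_eq e S
  · intro S _ S' _ h
    exact Submodule.map_injective_of_injective e.injective h
  · intro W hW
    simp only [Finset.mem_filter, Finset.mem_univ, true_and] at hW
    refine ⟨W.map (e.symm : D' →ₗ[F] D), ?_, ?_⟩
    · simp only [Finset.mem_filter, Finset.mem_univ, true_and]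
      rw [← hW]
      exact LinearEquiv.finrank_map_eq e.symm W
    · rw [← Submodule.map_comp]
      simp

lemma finrank_inf_hyper (D H : Submodule F V) (hH : Module.finrank F H + 1 = Module.finrank F V)
    (hD : ¬ D ≤ H) : Module.finrank F ↥(D ⊓ H) + 1 = Module.finrank F D := by
  obtain ⟨v, hv, hvS⟩ := SetLike.not_le_iff_exists.1 hD
  have h1 := Submodule.finrank_sup_add_finrank_inf_eq D H
  have h2 : D ⊔ H = ⊤ := by
    apply Submodule.eq_top_of_finrank_eq
    apply le_antisymm (Submodule.finrank_le _)
    rw [← hH, ← finrank_sup_span H v hvS]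
    apply Submodule.finrank_mono
    apply sup_le le_sup_right
    rw [Submodule.span_singleton_le_iff_mem]; exact Submodule.mem_sup_left hv
  rw [h2, finrank_top] at h1
  omega

/-- Number of h-subspaces in a hyperplane, in relation to the number of all h-subspaces. -/
lemma card_in_hyper (h k : ℕ) (hk : 1 ≤ k) (hV : Module.finrank F V = h + k) (H : Submodule F V)
    (hH : Module.finrank F H + 1 = Module.finrank F V) :
    gNum (Fintype.card F) (h + k) * ((Finset.univ : Finset (Submodule F V)).filter
      (fun S : Submodule F V => S ≤ H ∧ Module.finrank F S = h)).card =
    gNum (Fintype.card F) k * ((Finset.univ : Finset (Submodule F V)).filter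
      (fun S : Submodule F V => Module.finrank F S = h)).card := by
  obtain ⟨d, hd⟩ : ∃ d, h + k = d + 1 := ⟨h + k - 1, by omega⟩
  have key := Finset.sum_card_bipartiteAbove_eq_sum_card_bipartiteBelow
    (s := (Finset.univ : Finset (Submodule F V)).filter
      (fun S : Submodule F V => Module.finrank F S = h))
    (t := (Finset.univ : Finset (Submodule F V)).filter
      (fun S : Submodule F V => Module.finrank F S = d)) (fun S H => S ≤ H)
  have h1 : ∀ S ∈ (Finset.univ : Finset (Submodule F V)).filter
      (fun S : Submodule F V => Module.finrank F S = h),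
      (Finset.bipartiteAbove (fun S H : Submodule F V => S ≤ H)
      ((Finset.univ : Finset (Submodule F V)).filter
      (fun S : Submodule F V => Module.finrank F S = d)) S).card = gNum (Fintype.card F) k := by
    intro S hS
    simp only [Finset.mem_filter, Finset.mem_univ, true_and] at hS
    rw [← card_hyper_above S d k (by omega) (by omega)]
    congr 1
    ext W
    simp [Finset.bipartiteAbove, and_comm]
  have h2 : ∀ W ∈ (Finset.univ : Finset (Submodule F V)).filter
      (fun S : Submodule F V => Module.finrank F S = d),
      (Finset.bipartiteBelow (fun S H : Submodule F V => S ≤ H)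
      ((Finset.univ : Finset (Submodule F V)).filter
      (fun S : Submodule F V => Module.finrank F S = h)) W).card =
      ((Finset.univ : Finset (Submodule F V)).filter
      (fun S : Submodule F V => S ≤ H ∧ Module.finrank F S = h)).card := by
    intro W hW
    simp only [Finset.mem_filter, Finset.mem_univ, true_and] at hW
    rw [card_sub_congr H W h (by omega)]
    congr 1
    ext W
    simp [Finset.bipartiteBelow, and_comm]
  rw [Finset.sum_congr rfl h1, Finset.sum_congr rfl h2] at key
  simp only [Finset.sum_const, smul_eq_mul] at key
  rw [card_hyper d (by omega)] at key
  rw [hd, ← key, mul_comm]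

end geo

section lattice
set_option linter.unusedSectionVars false
variable {F V : Type*} [Field F] [Fintype F] [AddCommGroup V] [Module F V] [Fintype V]

/-- Indicator of non-containment. -/
def ind (A H : Submodule F V) : ℤ := if A ≤ H then 0 else 1

/-- Hyperplanes. -/
abbrev Hyp (F V : Type*) [Field F] [AddCommGroup V] [Module F V] :=
  {H : Submodule F V // Module.finrank F H + 1 = Module.finrank F V}

def indv (A : Submodule F V) : Hyp F V → ℤ := fun H => ind A H.1

/-- Data of a subspace: total one and its non-containment function. -/
def phi (S : Submodule F V) : ℤ × (Hyp F V → ℤ) := (1, indv S)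

def GG (F V : Type*) [Field F] [Fintype F] [AddCommGroup V] [Module F V] [Fintype V] (h : ℕ) :
    Finset (Submodule F V) :=
  (Finset.univ : Finset (Submodule F V)).filter (fun S : Submodule F V => Module.finrank F S = h)

def HLat (F V : Type*) [Field F] [Fintype F] [AddCommGroup V] [Module F V] [Fintype V] (h : ℕ) :
    Submodule ℤ (ℤ × (Hyp F V → ℤ)) :=
  Submodule.span ℤ (phi '' (GG F V h : Set (Submodule F V)))

lemma phi_mem (h : ℕ) (S : Submodule F V) (hS : Module.finrank F S = h) : phi S ∈ HLat F V h :=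
  Submodule.subset_span ⟨S, by simp [GG, hS], rfl⟩

lemma sum_phi (T : Finset (Submodule F V)) :
    ∑ S ∈ T, phi S = ((T.card : ℤ), fun H : Hyp F V =>
      (T.card : ℤ) - ((T.filter (fun S => S ≤ H.1)).card : ℤ)) := by
  have h1 : ∀ H : Hyp F V, ∑ S ∈ T, ind S H.1
      = (T.card : ℤ) - ((T.filter (fun S => S ≤ H.1)).card : ℤ) := by
    intro H
    have := Finset.card_filter_add_card_filter_not (s := T) (fun S => S ≤ H.1)
    rw [← this]
    push_cast
    simp only [ind]
    rw [add_sub_cancel_left, Finset.card_filter]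
    push_cast
    apply Finset.sum_congr rfl
    intro S _
    split_ifs <;> simp_all
  refine Prod.ext ?_ ?_
  · simp [Prod.fst_sum, phi]
  · ext H
    simp only [Prod.snd_sum, phi, Finset.sum_apply, indv]
    exact h1 H

lemma E_mem (h j : ℕ) (B D : Submodule F V) (hBD : B ≤ D) (hB : Module.finrank F B = h)
    (hD : Module.finrank F D = h + 1 + j) :
    (((gNum (Fintype.card F) (j+1) : ℕ) : ℤ),
      ((Fintype.card F : ℤ) ^ j) • indv D + ((gNum (Fintype.card F) j : ℕ) : ℤ) • indv B)
      ∈ HLat F V (h+1) := by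
  set T := (Finset.univ : Finset (Submodule F V)).filter
      (fun S => (B ≤ S ∧ S ≤ D) ∧ Module.finrank F S = Module.finrank F B + 1) with hT
  have hc := card_between B D hBD (j+1) (by omega)
  have hmem : ∑ S ∈ T, phi S ∈ HLat F V (h+1) := by
    apply Submodule.sum_mem
    intro S hS
    apply phi_mem
    simp [hT] at hS
    omega
  convert hmem using 1
  rw [sum_phi]
  refine Prod.ext ?_ ?_
  · simp [hT, hc]
  · ext H
    simp only [hT, hc, Pi.add_apply, Pi.smul_apply, smul_eq_mul, indv, ind]
    rw [Finset.filter_filter]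
    have hg := gNum_succ (Fintype.card F) j
    by_cases h1 : B ≤ H.1
    · by_cases h2 : D ≤ H.1
      · have : (Finset.univ : Finset (Submodule F V)).filter
          (fun S => ((B ≤ S ∧ S ≤ D) ∧ Module.finrank F S = Module.finrank F B + 1) ∧ S ≤ H.1)
          = (Finset.univ : Finset (Submodule F V)).filter
          (fun S => (B ≤ S ∧ S ≤ D) ∧ Module.finrank F S = Module.finrank F B + 1) := by
          ext S
          simp only [Finset.mem_filter, Finset.mem_univ, true_and]
          exact ⟨fun a => a.1, fun a => ⟨a, a.1.2.trans h2⟩⟩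
        rw [this, hc]
        simp [h1, h2]
      · have : (Finset.univ : Finset (Submodule F V)).filter
          (fun S => ((B ≤ S ∧ S ≤ D) ∧ Module.finrank F S = Module.finrank F B + 1) ∧ S ≤ H.1)
          = (Finset.univ : Finset (Submodule F V)).filter
          (fun S => (B ≤ S ∧ S ≤ D ⊓ H.1) ∧ Module.finrank F S = Module.finrank F B + 1) := by
          ext S
          simp only [Finset.mem_filter, Finset.mem_univ, true_and, le_inf_iff]
          tauto
        have hf := finrank_inf_hyper D H.1 H.2 h2
        rw [this, card_between B (D ⊓ H.1) (le_inf hBD h1) j (by omega), hg]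
        simp [h1, h2]
    · have h2 : ¬ D ≤ H.1 := fun h => h1 (hBD.trans h)
      have : (Finset.univ : Finset (Submodule F V)).filter
          (fun S => ((B ≤ S ∧ S ≤ D) ∧ Module.finrank F S = Module.finrank F B + 1) ∧ S ≤ H.1)
          = ∅ := by
          ext S
          simp only [Finset.mem_filter, Finset.mem_univ, true_and, Finset.notMem_empty, iff_false]
          exact fun a => h1 (a.1.1.1.trans a.2)
      rw [this, hg]
      simp [h1, h2]
      ring

lemma all_mem (h : ℕ) (D : Submodule F V) (hD : Module.finrank F D = h + 1) :
    (((gNum (Fintype.card F) (h+1) : ℕ) : ℤ),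
      (((gNum (Fintype.card F) (h+1) : ℕ) : ℤ) - 1) • indv D)
      ∈ HLat F V h := by
  set T := (Finset.univ : Finset (Submodule F V)).filter
      (fun S => S ≤ D ∧ Module.finrank F S = h) with hT
  have hc := card_hyper_in D h hD
  have hmem : ∑ S ∈ T, phi S ∈ HLat F V h := by
    apply Submodule.sum_mem
    intro S hS
    apply phi_mem
    simp [hT] at hS
    omega
  convert hmem using 1
  rw [sum_phi]
  refine Prod.ext ?_ ?_
  · simp [hT, hc]
  · ext H
    simp only [hT, hc, Pi.smul_apply, smul_eq_mul, indv, ind]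
    rw [Finset.filter_filter]
    by_cases h2 : D ≤ H.1
    · have : (Finset.univ : Finset (Submodule F V)).filter
          (fun S => (S ≤ D ∧ Module.finrank F S = h) ∧ S ≤ H.1)
          = (Finset.univ : Finset (Submodule F V)).filter
          (fun S => S ≤ D ∧ Module.finrank F S = h) := by
          ext S
          simp only [Finset.mem_filter, Finset.mem_univ, true_and]
          exact ⟨fun a => a.1, fun a => ⟨a, a.1.trans h2⟩⟩
      rw [this, hc]
      simp [h2]
    · have hf := finrank_inf_hyper D H.1 H.2 h2
      have : (Finset.univ : Finset (Submodule F V)).filter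
          (fun S => (S ≤ D ∧ Module.finrank F S = h) ∧ S ≤ H.1)
          = {D ⊓ H.1} := by
          ext S
          simp only [Finset.mem_filter, Finset.mem_univ, true_and, Finset.mem_singleton]
          constructor
          · rintro ⟨⟨a, b⟩, c⟩
            exact Submodule.eq_of_le_of_finrank_eq (le_inf a c) (by omega)
          · rintro rfl
            exact ⟨⟨inf_le_left, by omega⟩, inf_le_right⟩
      rw [this]
      simp [h2]

/-- The relation `[h] w = 0`. -/
lemma Q_mem (h : ℕ) (B : Submodule F V) (hB : Module.finrank F B = h)
    (hV : h + 2 ≤ Module.finrank F V) :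
    (((gNum (Fintype.card F) (h+1) : ℕ) : ℤ) - 1,
      ((gNum (Fintype.card F) (h+1) : ℕ) : ℤ) • indv B) ∈ HLat F V (h+1) := by
  obtain ⟨D, hBD, -, hD⟩ := exists_between_finrank B ⊤ le_top (h+2) (by omega) (by simpa using hV)
  have h1 := all_mem (h+1) D hD
  have h2 := E_mem h 1 B D hBD hB (by omega)
  have h3 := Submodule.sub_mem _
    (Submodule.smul_mem _ ((gNum (Fintype.card F) (h+1) : ℕ) : ℤ) h2) h1
  have g1 := gNum_succ (Fintype.card F) (h+1)
  have g2 := gNum_succ' (Fintype.card F) (h+1)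
  have g3 : gNum (Fintype.card F) 1 = 1 := by simp [gNum]
  have g4 : gNum (Fintype.card F) 2 = 1 + Fintype.card F := by simp [gNum, Finset.sum_range_succ]
  convert h3 using 1
  refine Prod.ext ?_ ?_
  · simp only [Prod.smul_mk, Prod.mk_sub_mk, smul_eq_mul, Nat.reduceAdd, g4]
    rw [g2]; push_cast; ring
  · ext H
    simp only [Prod.smul_mk, Prod.mk_sub_mk, Pi.sub_apply, Pi.smul_apply, Pi.add_apply,
      smul_eq_mul, g3]
    rw [g2]; push_cast; ring

/-- Core lattice membership. -/
lemma tau_mem (h k : ℕ) (hk : 1 ≤ k) (hV : Module.finrank F V = h + 1 + k)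
    (B A : Submodule F V) (AA : ℕ → Submodule F V)
    (hB : Module.finrank F B = h) (hA : Module.finrank F A = h + 1)
    (hAA : ∀ j < k, B ≤ AA j ∧ Module.finrank F (AA j) = h + 1 + j)
    (N s σ e : ℤ) (ε : ℕ → ℤ)
    (h1 : σ * (Fintype.card F : ℤ) ^ k - ∑ j ∈ Finset.range k, ε j * (Fintype.card F : ℤ) ^ j
      = N - s)
    (h2 : σ * gNum (Fintype.card F) k - ∑ j ∈ Finset.range k, ε j * gNum (Fintype.card F) j + e
      = gNum (Fintype.card F) (h+1) * s) :
    (N, fun H : Hyp F V => σ * (Fintype.card F : ℤ) ^ k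
      - ∑ j ∈ Finset.range k, ε j * (Fintype.card F : ℤ) ^ j * ind (AA j) H.1
      + e * (ind A H.1 - ind B H.1)) ∈ HLat F V (h+1) := by
  have m1 := Submodule.smul_mem _ σ (E_mem h k B ⊤ le_top hB (by simpa using hV))
  have m2 := Submodule.sum_mem (HLat F V (h+1)) (t := Finset.range k)
    (f := fun j => ε j • ((((gNum (Fintype.card F) (j+1) : ℕ) : ℤ),
      ((Fintype.card F : ℤ) ^ j) • indv (AA j) + ((gNum (Fintype.card F) j : ℕ) : ℤ) • indv B)
      : ℤ × (Hyp F V → ℤ))) (by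
      intro j hj
      have := hAA j (by simpa using hj)
      exact Submodule.smul_mem _ _ (E_mem h j B (AA j) this.1 hB this.2))
  have m3 := Submodule.smul_mem _ e (phi_mem (h+1) A hA)
  have m4 := Submodule.smul_mem _ s (Q_mem h B hB (by omega))
  have m5 := Submodule.sub_mem _ (Submodule.add_mem _ (Submodule.sub_mem _ m1 m2) m3) m4
  convert m5 using 1
  refine Prod.ext ?_ ?_
  · simp only [Prod.smul_mk, Prod.fst_sub, Prod.fst_add, Prod.fst_sum, smul_eq_mul, phi]
    have : ∑ j ∈ Finset.range k, ε j * ((gNum (Fintype.card F) (j+1) : ℕ) : ℤ) =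
      ∑ j ∈ Finset.range k, ε j * gNum (Fintype.card F) j +
      ∑ j ∈ Finset.range k, ε j * (Fintype.card F : ℤ) ^ j := by
      rw [← Finset.sum_add_distrib]
      apply Finset.sum_congr rfl
      intro j _
      rw [gNum_succ]; push_cast; ring
    rw [this, gNum_succ _ k]
    push_cast
    linear_combination -h1 - h2
  · ext H
    have htop : ind ⊤ H.1 = 1 := by
      have : ¬ (⊤ : Submodule F V) ≤ H.1 := by
        intro hh
        have := H.2
        rw [top_le_iff.1 hh, finrank_top] at this
        omega
      simp only [ind, this, if_false]
    simp only [Prod.smul_mk, Prod.snd_sub, Prod.snd_add, Prod.snd_sum, smul_eq_mul, phi,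
      Pi.sub_apply, Pi.add_apply, Pi.smul_apply, Finset.sum_apply, indv, htop]
    have : ∑ j ∈ Finset.range k, ε j * ((Fintype.card F : ℤ) ^ j * ind (AA j) H.1 +
        gNum (Fintype.card F) j * ind B H.1) =
      ∑ j ∈ Finset.range k, ε j * (Fintype.card F : ℤ) ^ j * ind (AA j) H.1 +
      (∑ j ∈ Finset.range k, ε j * gNum (Fintype.card F) j) * ind B H.1 := by
      rw [Finset.sum_mul, ← Finset.sum_add_distrib]
      apply Finset.sum_congr rfl
      intro j _
      ring
    rw [this]
    linear_combination (-ind B H.1) * h2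

end lattice

lemma tele1 (q : ℤ) (D : ℕ → ℤ) (k : ℕ) :
    D k * q ^ k - ∑ j ∈ Finset.range k, (q * D (j+1) - D j) * q ^ j = D 0 := by
  induction k with
  | zero => simp
  | succ k ih => rw [Finset.sum_range_succ]; linear_combination ih

lemma tele2 (q : ℕ) (D : ℕ → ℤ) (k : ℕ) :
    D k * gNum q k - ∑ j ∈ Finset.range k, ((q:ℤ) * D (j+1) - D j) * gNum q j
      = ∑ j ∈ Finset.range k, D (j+1) := by
  induction k with
  | zero => simp [gNum]
  | succ k ih =>
    rw [Finset.sum_range_succ, Finset.sum_range_succ, ← ih, gNum_succ']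
    push_cast
    ring

/-- Ceiling division. -/
def cdv (q d i : ℕ) : ℕ := (d + q ^ i - 1) / q ^ i

lemma cdv_le_iff (q d i c : ℕ) (hq : 0 < q) : cdv q d i ≤ c ↔ d ≤ c * q ^ i := by
  have hp : 0 < q ^ i := by positivity
  unfold cdv
  rw [Nat.div_le_iff_le_mul_add_pred hp, mul_comm]
  omega

lemma cdv_step (q d j : ℕ) (hq : 0 < q) : cdv q d j ≤ q * cdv q d (j+1) := by
  rw [cdv_le_iff _ _ _ _ hq]
  have := (cdv_le_iff q d (j+1) _ hq).1 le_rfl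
  calc d ≤ _ := this
    _ = _ := by ring

lemma griesmer_eq (q h k D : ℕ) (hq : 0 < q) :
    griesmer q (h+1+k) (q ^ h * D) = gNum q (h+1) * D + ∑ j ∈ Finset.range k, cdv q D (j+1) := by
  have hg : griesmer q (h+1+k) (q ^ h * D) = ∑ i ∈ Finset.range (h+1+k), cdv q (q ^ h * D) i := rfl
  rw [hg, Finset.sum_range_add]
  congr 1
  · rw [gNum, Finset.sum_mul, ← Finset.sum_range_reflect]
    apply Finset.sum_congr rfl
    intro i hi
    have hi : i ≤ h := by simp at hi; omega
    have hh : h + 1 - 1 - i = h - i := by omega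
    rw [hh]
    obtain ⟨j, rfl⟩ := Nat.exists_eq_add_of_le hi
    have hp : 0 < q ^ (i + j - i) := by positivity
    apply le_antisymm
    · rw [cdv_le_iff _ _ _ _ hq]
      simp only [Nat.add_sub_cancel_left]
      apply le_of_eq; ring
    · have := (cdv_le_iff q (q ^ (i+j) * D) (i+j-i) _ hq).1 le_rfl
      refine Nat.le_of_mul_le_mul_right ?_ hp
      refine le_trans (le_of_eq ?_) this
      simp only [Nat.add_sub_cancel_left]
      ring
  · apply Finset.sum_congr rfl
    intro j _
    have hp : 0 < q ^ h := by positivity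
    apply eq_of_forall_ge_iff
    intro c
    rw [cdv_le_iff _ _ _ _ hq, cdv_le_iff _ _ _ _ hq,
      show c * q ^ (h + 1 + j) = q ^ h * (c * q ^ (j+1)) by ring]
    exact Nat.mul_le_mul_left_iff hp

lemma cnt_real {F V : Type*} [Field F] [Fintype F] [AddCommGroup V] [Module F V] [Fintype V]
    (T : Finset (Submodule F V)) (z : Submodule F V → ℕ) :
    ∃ M : Multiset (Submodule F V), (∀ W ∈ M, W ∈ T) ∧ Multiset.card M = ∑ S ∈ T, z S ∧
      ∀ H, (cnt M H : ℤ) = ∑ S ∈ T, (z S : ℤ) * (1 - ind S H) := by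
  refine ⟨∑ S ∈ T, Multiset.replicate (z S) S, ?_, ?_, ?_⟩
  · intro W hW
    rw [Multiset.mem_sum] at hW
    obtain ⟨S, hS, hW⟩ := hW
    rw [Multiset.eq_of_mem_replicate hW]; exact hS
  · simp
  · intro H
    induction T using Finset.induction_on with
    | empty => simp [cnt]
    | insert a T ha ih =>
      rw [Finset.sum_insert ha, Finset.sum_insert ha, ← ih]
      simp only [cnt, Multiset.countP_add, ind]
      push_cast
      congr 1
      by_cases h : a ≤ H
      · have : Multiset.countP (fun W => W ≤ H) (Multiset.replicate (z a) a) = z a := by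
          rw [Multiset.countP_eq_card.2, Multiset.card_replicate]
          intro b hb
          rw [Multiset.eq_of_mem_replicate hb]; exact h
        simp [h, this]
      · have : Multiset.countP (fun W => W ≤ H) (Multiset.replicate (z a) a) = 0 := by
          rw [Multiset.countP_eq_zero]
          intro b hb
          rw [Multiset.eq_of_mem_replicate hb]; exact h
        simp [h, this]

lemma lat_real {F V : Type*} [Field F] [Fintype F] [AddCommGroup V] [Module F V] [Fintype V]
    (h : ℕ) (N : ℤ) (ν : Hyp F V → ℤ) (hm : (N, ν) ∈ HLat F V h) :
    ∃ x : Submodule F V → ℤ, ∑ S ∈ GG F V h, x S = N ∧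
      ∀ H : Hyp F V, ∑ S ∈ GG F V h, x S * ind S H.1 = ν H := by
  unfold HLat at hm
  rw [Submodule.mem_span_image_finset_iff_exists_fun'] at hm
  obtain ⟨x, hx⟩ := hm
  refine ⟨x, ?_, ?_⟩
  · have := congrArg Prod.fst hx
    simpa [Prod.fst_sum, phi] using this
  · intro H
    have := congrFun (congrArg Prod.snd hx) H
    simpa [Prod.snd_sum, phi, indv] using this

set_option maxHeartbeats 2000000 in
lemma main_aux (F : Type*) [Field F] [Fintype F] (V : Type*) [AddCommGroup V] [Module F V]
    [Fintype V] (n s h k r1 h1 k1 : ℕ) (hk : 1 ≤ k) (hsn : s ≤ n)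
    (hV : Module.finrank F V = h + 1 + k)
    (hr1 : r1 = k1 + (Fintype.card F) ^ k * h1) (hh1 : 1 ≤ h1)
    (hhk : h1 * gNum (Fintype.card F) k = gNum (Fintype.card F) (h+1) * k1)
    (hrk : r1 * gNum (Fintype.card F) k = gNum (Fintype.card F) (h+1+k) * k1)
    (hG : ∑ j ∈ Finset.range k, cdv (Fintype.card F) (n - s) (j+1)
      ≤ gNum (Fintype.card F) (h+1) * s) :
    ∃ t₀ : ℕ, ∀ t : ℕ, t₀ ≤ t → ∃ M : Multiset (Submodule F V),
      (∀ W ∈ M, Module.finrank F W = h + 1) ∧ Multiset.card M = n + t * r1 ∧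
      (∀ H : Hyp F V, cnt M H.1 ≤ s + t * k1) ∧ ∃ H : Hyp F V, cnt M H.1 = s + t * k1 := by
  have hq0 : 0 < Fintype.card F := Fintype.card_pos
  set q := Fintype.card F with hq
  -- geometric configuration
  obtain ⟨H0, -, -, hH0⟩ := exists_between_finrank (⊥ : Submodule F V) ⊤ bot_le (h + k)
    (by simp) (by simp; omega)
  obtain ⟨A, -, hAH, hA⟩ := exists_between_finrank (⊥ : Submodule F V) H0 bot_le (h + 1)
    (by simp) (by omega)
  obtain ⟨B, -, hBA, hB⟩ := exists_between_finrank (⊥ : Submodule F V) A bot_le h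
    (by simp) (by omega)
  have hne : ¬ (⊤ : Submodule F V) ≤ H0 := by
    intro hle
    have := Submodule.finrank_mono hle
    rw [finrank_top] at this
    omega
  obtain ⟨v, -, hv⟩ := SetLike.not_le_iff_exists.1 hne
  have hvB : v ∉ B := fun hvB => hv (hAH (hBA hvB))
  have hAA : ∀ j, ∃ S : Submodule F V, j < k →
      (B ≤ S ∧ Module.finrank F S = h + 1 + j ∧ ¬ S ≤ H0) := by
    intro j
    by_cases hj : j < k
    · have hs := finrank_sup_span B v hvB
      obtain ⟨S, h1, -, h2⟩ := exists_between_finrank (B ⊔ F ∙ v) ⊤ le_top (h + 1 + j)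
        (by omega) (by rw [finrank_top]; omega)
      refine ⟨S, fun _ => ⟨le_sup_left.trans h1, h2, fun hle => hv (hle (h1 ?_))⟩⟩
      exact Submodule.mem_sup_right (Submodule.mem_span_singleton_self v)
    · exact ⟨⊥, fun h => absurd h hj⟩
  choose AA hAA using hAA
  -- numbers
  set D : ℕ → ℤ := fun j => (cdv q (n - s) j : ℤ) with hD
  have hD0 : D 0 = (n : ℤ) - s := by simp [hD, cdv]; omega
  set ε : ℕ → ℤ := fun j => (q : ℤ) * D (j+1) - D j with hε
  have hε0 : ∀ j, 0 ≤ ε j := by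
    intro j
    have := cdv_step q (n - s) j hq0
    simp only [hε, hD, sub_nonneg]
    exact_mod_cast this
  set e : ℤ := gNum q (h+1) * s - ∑ j ∈ Finset.range k, D (j+1) with he
  have he0 : 0 ≤ e := by
    simp only [he, hD, sub_nonneg]
    exact_mod_cast hG
  have t1 := tele1 q D k
  have t2 := tele2 q D k
  have m0 := tau_mem h k hk hV B A AA hB hA (fun j hj => ⟨(hAA j hj).1, (hAA j hj).2.1⟩)
    n s (D k) e ε (by rw [← hD0, ← t1]) (by rw [← hq]; simp only [hε]; rw [t2]; simp [he])
  have my := tau_mem h k hk hV B A AA hB hA (fun j hj => ⟨(hAA j hj).1, (hAA j hj).2.1⟩)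
    r1 k1 h1 0 (fun _ => 0)
    (by rw [hr1, ← hq]; push_cast; simp; ring) (by rw [← hq]; simp; exact_mod_cast hhk)
  obtain ⟨x, hx1, hx2⟩ := lat_real _ _ _ m0
  obtain ⟨y, hy1, hy2⟩ := lat_real _ _ _ my
  rw [← hq] at hx2 hy2
  set T := (GG F V (h+1)).card with hT
  have hTpos : 0 < T := Finset.card_pos.2 ⟨A, by simp [GG, hA]⟩
  have hJ : ∀ H : Hyp F V, (r1 : ℤ) * ∑ S ∈ GG F V (h+1), ind S H.1 = T * ((r1 : ℤ) - k1) := by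
    intro H
    have a1 := congrFun (congrArg Prod.snd (sum_phi (GG F V (h+1)))) H
    simp only [Prod.snd_sum, Finset.sum_apply, phi, indv] at a1
    rw [a1]
    have a2 := card_in_hyper (h+1) k hk hV H.1 H.2
    have a3 : (GG F V (h+1)).filter (fun S => S ≤ H.1) = (Finset.univ : Finset (Submodule F V)).filter
      (fun S : Submodule F V => S ≤ H.1 ∧ Module.finrank F S = h+1) := by
      ext S; simp [GG, and_comm]
    rw [a3]
    change _ = _ * T at a2
    rw [← hq] at a2
    set c := ((Finset.univ : Finset (Submodule F V)).filter
      (fun S : Submodule F V => S ≤ H.1 ∧ Module.finrank F S = h+1)).card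
    have gpos : 0 < gNum q (h+1+k) := by
      rw [show h+1+k = (h+k)+1 by ring, gNum_succ']; omega
    have a4 : r1 * c = T * k1 := by
      apply Nat.eq_of_mul_eq_mul_left gpos
      calc gNum q (h+1+k) * (r1 * c) = r1 * (gNum q (h+1+k) * c) := by ring
        _ = (r1 * gNum q k) * T := by rw [a2]; ring
        _ = _ := by rw [hrk]; ring
    have a5 : (r1 : ℤ) * c = T * k1 := by exact_mod_cast a4
    linear_combination -a5
  have hr1pos : (1:ℤ) ≤ r1 := by
    have : 0 < q ^ k * h1 := by positivity
    rw [hr1]; push_cast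
    have : (0:ℤ) < q ^ k * h1 := by exact_mod_cast this
    omega
  set u0 : ℕ := ∑ S ∈ GG F V (h+1), ((x S).natAbs + T * (y S).natAbs) with hu0
  refine ⟨T * u0, fun t ht => ?_⟩
  set u := t / T with hu
  set ρ := t % T with hρ
  have htd : (t : ℤ) = T * u + ρ := by
    have := Nat.div_add_mod t T
    exact_mod_cast this.symm
  have hρT : ρ < T := Nat.mod_lt _ hTpos
  have huu : u0 ≤ u := by
    rw [hu, Nat.le_div_iff_mul_le hTpos]; rw [mul_comm]; exact ht
  have hz : ∀ S ∈ GG F V (h+1), 0 ≤ x S + ρ * y S + u * r1 := by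
    intro S hS
    have b1 : (x S).natAbs + T * (y S).natAbs ≤ u0 :=
      Finset.single_le_sum (f := fun S => (x S).natAbs + T * (y S).natAbs)
        (fun _ _ => Nat.zero_le _) hS
    have b2 : ((x S).natAbs : ℤ) + T * ((y S).natAbs : ℤ) ≤ u := by
      exact_mod_cast b1.trans huu
    have b3 : (u : ℤ) ≤ u * r1 := by
      have : (0:ℤ) ≤ u := by positivity
      nlinarith
    have b4 : -(T * ((y S).natAbs : ℤ)) ≤ ρ * y S := by
      have c1 : -(ρ * ((y S).natAbs : ℤ)) ≤ ρ * y S := by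
        have : -((y S).natAbs : ℤ) ≤ y S := by omega
        have := mul_le_mul_of_nonneg_left this (show (0:ℤ) ≤ ρ by positivity)
        linarith
      have c2 : (ρ : ℤ) * ((y S).natAbs : ℤ) ≤ T * ((y S).natAbs : ℤ) := by
        apply mul_le_mul_of_nonneg_right
        · exact_mod_cast hρT.le
        · positivity
      linarith
    have b5 : -((x S).natAbs : ℤ) ≤ x S := by omega
    linarith
  obtain ⟨M, hM1, hM2, hM3⟩ := cnt_real (GG F V (h+1)) (fun S => (x S + ρ * y S + u * r1).toNat)
  have hsum : ∑ S ∈ GG F V (h+1), (x S + ρ * y S + u * r1) = n + t * r1 := by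
    rw [Finset.sum_add_distrib, Finset.sum_add_distrib, ← Finset.mul_sum, hx1, hy1,
      Finset.sum_const, nsmul_eq_mul, htd]
    ring
  have hcnt : ∀ H : Hyp F V, (cnt M H.1 : ℤ) = n + t * k1 - (D k * (q:ℤ) ^ k
      - ∑ j ∈ Finset.range k, ε j * (q : ℤ) ^ j * ind (AA j) H.1
      + e * (ind A H.1 - ind B H.1)) := by
    intro H
    rw [hM3, ← hx2 H]
    have d1 : ∑ S ∈ GG F V (h+1), (((x S + ρ * y S + u * r1).toNat : ℕ) : ℤ) * (1 - ind S H.1)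
      = ∑ S ∈ GG F V (h+1), (x S + ρ * y S + u * r1)
        - (∑ S ∈ GG F V (h+1), x S * ind S H.1 + ρ * ∑ S ∈ GG F V (h+1), y S * ind S H.1
          + u * (r1 * ∑ S ∈ GG F V (h+1), ind S H.1)) := by
      simp only [Finset.mul_sum]
      rw [← Finset.sum_add_distrib, ← Finset.sum_add_distrib, ← Finset.sum_sub_distrib]
      apply Finset.sum_congr rfl
      intro S hS
      rw [Int.toNat_of_nonneg (hz S hS)]
      ring
    rw [d1, hsum, hJ H, hy2 H]
    simp only [zero_mul, Finset.sum_const_zero, add_zero, sub_zero]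
    have hr1' : (r1 : ℤ) = k1 + (q:ℤ) ^ k * h1 := by rw [hr1]; push_cast; rfl
    rw [htd, hr1']
    ring
  have ind0 : ∀ X H : Submodule F V, 0 ≤ ind X H ∧ ind X H ≤ 1 := by
    intro X H; unfold ind; split_ifs <;> simp
  have t1' : D k * (q:ℤ) ^ k - ∑ j ∈ Finset.range k, ε j * (q:ℤ) ^ j = (n:ℤ) - s := by
    rw [← hD0, ← t1]
  refine ⟨M, ?_, ?_, ?_, ?_⟩
  · intro W hW
    simpa [GG] using hM1 W hW
  · rw [hM2]
    have : ((∑ S ∈ GG F V (h+1), (x S + ρ * y S + u * r1).toNat : ℕ) : ℤ) = n + t * r1 := by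
      rw [← hsum]; push_cast
      exact Finset.sum_congr rfl fun S hS => by
        have := hz S hS
        omega
    exact_mod_cast this
  · intro H
    have c1 := hcnt H
    have c2 : ∑ j ∈ Finset.range k, ε j * (q : ℤ) ^ j * ind (AA j) H.1 ≤
        ∑ j ∈ Finset.range k, ε j * (q : ℤ) ^ j := by
      apply Finset.sum_le_sum
      intro j _
      have p1 : 0 ≤ ε j * (q : ℤ) ^ j := mul_nonneg (hε0 j) (by positivity)
      have := mul_le_mul_of_nonneg_left (ind0 (AA j) H.1).2 p1
      linarith
    have c3 : 0 ≤ ind A H.1 - ind B H.1 := by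
      unfold ind
      by_cases hAH : A ≤ H.1
      · simp [hAH, hBA.trans hAH]
      · simp only [hAH, if_false]; split_ifs <;> simp
    have c4 := mul_nonneg he0 c3
    have : (cnt M H.1 : ℤ) ≤ s + t * k1 := by linarith
    exact_mod_cast this
  · refine ⟨⟨H0, by omega⟩, ?_⟩
    have c1 := hcnt ⟨H0, by omega⟩
    have c2 : ∑ j ∈ Finset.range k, ε j * (q : ℤ) ^ j * ind (AA j) H0 =
        ∑ j ∈ Finset.range k, ε j * (q : ℤ) ^ j := by
      apply Finset.sum_congr rfl
      intro j hj
      have := (hAA j (by simpa using hj)).2.2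
      simp [ind, this]
    have c3 : ind A H0 - ind B H0 = 0 := by
      simp [ind, hAH, hBA.trans hAH]
    simp only [c2, c3] at c1
    have : (cnt M H0 : ℤ) = s + t * k1 := by linarith
    exact_mod_cast this

theorem statement2 (F : Type*) [Field F] [Fintype F] (q n s r h : ℕ)
    (hq : q = Fintype.card F) (hs : 1 ≤ s) (hsn : s < n) (hh : 1 ≤ h) (hhr : h < r)
    (hGriesmer : griesmer q r (q ^ (h - 1) * (n - s)) ≤ gNum q h * n) :
    ∃ t₀ : ℕ, ∀ t : ℕ, t₀ ≤ t →
      ∃ S : Multiset (Submodule F (Fin r → F)),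
        IsFaithful h S ∧
        IsSystem h (n + t * (gNum q r / gNum q (Nat.gcd r h)))
          (s + t * (gNum q (r - h) / gNum q (Nat.gcd r h))) S := by
  subst hq
  have hq0 : 0 < Fintype.card F := Fintype.card_pos
  obtain ⟨h, rfl⟩ : ∃ h', h = h' + 1 := ⟨h - 1, by omega⟩
  obtain ⟨k, rfl⟩ := Nat.exists_eq_add_of_le hhr.le
  have hk : 1 ≤ k := by omega
  rw [Nat.add_sub_cancel, griesmer_eq _ _ _ _ hq0] at hGriesmer
  rw [Nat.add_sub_cancel_left]
  set q := Fintype.card F with hq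
  set g := Nat.gcd (h + 1 + k) (h + 1) with hg
  have gr : g ∣ h + 1 + k := Nat.gcd_dvd_left _ _
  have gh : g ∣ h + 1 := Nat.gcd_dvd_right _ _
  have gk : g ∣ k := (Nat.dvd_add_right gh).1 gr
  obtain ⟨r1, hr1⟩ := gNum_dvd q _ _ gr
  obtain ⟨h1, hh1⟩ := gNum_dvd q _ _ gh
  obtain ⟨k1, hk1⟩ := gNum_dvd q _ _ gk
  have gpos : 0 < gNum q g := by
    have : 0 < g := Nat.gcd_pos_of_pos_right _ (by omega)
    obtain ⟨g', hg'⟩ : ∃ g', g = g' + 1 := ⟨g - 1, by omega⟩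
    rw [hg', gNum_succ']; omega
  have e1 : gNum q (h+1+k) / gNum q g = r1 := by rw [hr1, Nat.mul_div_cancel_left _ gpos]
  have e2 : gNum q k / gNum q g = k1 := by rw [hk1, Nat.mul_div_cancel_left _ gpos]
  rw [e1, e2]
  obtain ⟨t₀, ht₀⟩ := main_aux F (Fin (h+1+k) → F) n s h k r1 h1 k1 hk hsn.le (by simp)
    (by
      apply Nat.eq_of_mul_eq_mul_left gpos
      rw [← hr1, add_comm, gNum_add, hk1, hh1, ← hq]; ring)
    (by
      rcases Nat.eq_zero_or_pos h1 with h0 | h0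
      · rw [h0, gNum_succ'] at hh1; omega
      · exact h0)
    (by rw [← hq, hk1, hh1]; ring)
    (by rw [← hq, hk1, hr1]; ring)
    (by
      rw [← hq]
      obtain ⟨D, rfl⟩ := Nat.exists_eq_add_of_le hsn.le
      rw [Nat.add_sub_cancel_left] at hGriesmer ⊢
      rw [mul_add] at hGriesmer
      omega)
  refine ⟨t₀, fun t ht => ?_⟩
  obtain ⟨M, a, b, c, ⟨H, hH⟩⟩ := ht₀ t ht
  refine ⟨M, a, b, fun W hW => (a W hW).le, fun H hH => c ⟨H, by simp; omega⟩, H.1, ?_, hH⟩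
  have := H.2
  simp at this
  omega
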